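/- Reverse hypercontractivity from the 2-log-Sobolev inequality: Let T : M_d → M_d be a unital, reversible, primitive quantum channel, let c₀ > 0, and let L = c₀(id − T) generate the semigroup T_t = e^{−tL}. Assume the semigroup satisfies a 2-log-Sobolev inequality with constant α > 0: Ent(f²) ≤ α E_L(f,f) for all positive semidefinite f ∈ M_d. Let f ∈ M_d be positive semidefinite and let −∞ < q ≤ p ≤ 1 with p ≠ 0, q ≠ 0 (if p < 0, assume f is positive definite). Then for all t ≥ (α/4) ln((1−q)/(1−p)), one has ‖T_t(f)‖_q ≥ ‖f‖_p. -/

import Mathlib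

open Matrix
open scoped ComplexOrder

noncomputable section

/-- Apply a real function to a Hermitian matrix via the functional calculus
(junk value `0` on non-Hermitian matrices). -/
def hermFC {ι : Type*} [Fintype ι] [DecidableEq ι] (φ : ℝ → ℝ)
    (f : Matrix ι ι ℂ) : Matrix ι ι ℂ :=
  if hf : f.IsHermitian then
    (hf.eigenvectorUnitary : Matrix ι ι ℂ) *
      Matrix.diagonal (fun i => (φ (hf.eigenvalues i) : ℂ)) *
      (star hf.eigenvectorUnitary : Matrix ι ι ℂ)
  else 0

/-- Real matrix powers of a Hermitian matrix, via the functional calculus on eigenvalues. -/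
def mpow {ι : Type*} [Fintype ι] [DecidableEq ι] (f : Matrix ι ι ℂ) (a : ℝ) :
    Matrix ι ι ℂ :=
  hermFC (fun x => x ^ a) f

/-- The normalized trace `τ(f) = Tr f / d` (real part). -/
def ntrace {ι : Type*} [Fintype ι] [DecidableEq ι] (f : Matrix ι ι ℂ) : ℝ :=
  (f.trace).re / (Fintype.card ι)

/-- Normalized Schatten p-'norm': `‖f‖_p = ((1/d) Tr |f|^p)^(1/p)` with `|f| = √(f† f)`. -/
def snorm {ι : Type*} [Fintype ι] [DecidableEq ι] (p : ℝ) (f : Matrix ι ι ℂ) : ℝ :=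
  (ntrace (mpow (fᴴ * f) (p / 2))) ^ (1 / p)

/-- The entropy `Ent(f) = τ(f ln f) − τ(f) ln τ(f)`. -/
def mEnt {ι : Type*} [Fintype ι] [DecidableEq ι] (f : Matrix ι ι ℂ) : ℝ :=
  ntrace (hermFC (fun x => x * Real.log x) f) - ntrace f * Real.log (ntrace f)

/-- The Dirichlet form `E_L(f,g) = τ(f L(g))`. -/
def dirichlet {ι : Type*} [Fintype ι] [DecidableEq ι]
    (L : Matrix ι ι ℂ → Matrix ι ι ℂ) (f g : Matrix ι ι ℂ) : ℝ :=
  ntrace (f * L g)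

/-- Complete positivity: every matrix extension `id_m ⊗ T` maps PSD matrices to PSD matrices. -/
def IsCompletelyPositive {ι : Type*} [Fintype ι] [DecidableEq ι]
    (T : Matrix ι ι ℂ → Matrix ι ι ℂ) : Prop :=
  ∀ (m : ℕ) (M : Matrix (Fin m × ι) (Fin m × ι) ℂ), M.PosSemidef →
    (Matrix.of fun p q : Fin m × ι =>
      T (Matrix.of fun i j : ι => M (p.1, i) (q.1, j)) p.2 q.2).PosSemidef

/-- A quantum channel: a linear, completely positive, trace-preserving map. -/
def IsQChannel {ι : Type*} [Fintype ι] [DecidableEq ι]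
    (T : Matrix ι ι ℂ → Matrix ι ι ℂ) : Prop :=
  IsLinearMap ℂ T ∧ IsCompletelyPositive T ∧ ∀ f, (T f).trace = f.trace

/-- Reversibility (detailed balance w.r.t. the trace): `τ(f T(g)) = τ(T(f) g)`. -/
def IsReversible {ι : Type*} [Fintype ι] [DecidableEq ι]
    (T : Matrix ι ι ℂ → Matrix ι ι ℂ) : Prop :=
  ∀ f g : Matrix ι ι ℂ, (f * T g).trace = (T f * g).trace

/-- Primitivity: iterates of `T` converge on every density matrix to a fixed
full-rank state independent of the input. -/
def IsPrimitive {ι : Type*} [Fintype ι] [DecidableEq ι]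
    (T : Matrix ι ι ℂ → Matrix ι ι ℂ) : Prop :=
  ∃ σ : Matrix ι ι ℂ, σ.PosDef ∧ σ.trace = 1 ∧
    ∀ ρ : Matrix ι ι ℂ, ρ.PosSemidef → ρ.trace = 1 →
      Filter.Tendsto (fun k => T^[k] ρ) Filter.atTop (nhds σ)

/-- The depolarizing channel with parameter `γ` applied to the `k`-th qubit of `n` qubits:
`D_γ(f) = γ f + (1−γ) (tr_k f) ⊗_k (I/2)`. -/
def depolAt {n : ℕ} (γ : ℝ) (k : Fin n)
    (f : Matrix (Fin n → Fin 2) (Fin n → Fin 2) ℂ) :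
    Matrix (Fin n → Fin 2) (Fin n → Fin 2) ℂ :=
  Matrix.of fun x y =>
    (γ : ℂ) * f x y +
      ((1 - γ : ℝ) : ℂ) *
        (if x k = y k then
          (1 / 2) * ∑ b : Fin 2, f (Function.update x k b) (Function.update y k b)
        else 0)

/-- The tensor power `D_γ^{⊗n}` of the qubit depolarizing channel, acting on `n` qubits. -/
def depolChannel {n : ℕ} (γ : ℝ)
    (f : Matrix (Fin n → Fin 2) (Fin n → Fin 2) ℂ) :
    Matrix (Fin n → Fin 2) (Fin n → Fin 2) ℂ :=
  (List.finRange n).foldl (fun g k => depolAt γ k g) f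

/-- The semigroup element `e^{−tL}` applied to `f`, defined by its power series. -/
def opExp {ι : Type*} [Fintype ι] [DecidableEq ι]
    (L : Matrix ι ι ℂ → Matrix ι ι ℂ) (t : ℝ) (f : Matrix ι ι ℂ) : Matrix ι ι ℂ :=
  ∑' k : ℕ, (((-t) ^ k / (Nat.factorial k) : ℝ) : ℂ) • L^[k] f

/-- The classical noise operator `T_γ` on functions on the boolean cube:
each bit is flipped independently with probability `(1−γ)/2`. -/
def noiseOp {n : ℕ} (γ : ℝ) (f : (Fin n → Fin 2) → ℝ) : (Fin n → Fin 2) → ℝ :=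
  fun x => ∑ y : Fin n → Fin 2,
    (∏ i : Fin n, if y i = x i then (1 + γ) / 2 else (1 - γ) / 2) * f y

/-- The normalized `ℓ_p` 'norm' `‖f‖_p = (2^{-n} Σ_x |f(x)|^p)^{1/p}` on the boolean cube. -/
def lpnorm {n : ℕ} (p : ℝ) (f : (Fin n → Fin 2) → ℝ) : ℝ :=
  ((∑ x : Fin n → Fin 2, |f x| ^ p) / 2 ^ n) ^ (1 / p)

end

/-- Bernoulli's inequality for the concave functions `u ↦ u ^ q / q` with `q < 1`. -/
lemma rpow_sub_one_div_le {q u : ℝ} (hq : q < 1) (hq0 : q ≠ 0) (hu : 0 < u) :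
    (u ^ q - 1) / q ≤ u - 1 := by
  rcases lt_or_gt_of_ne hq0 with h | h
  · rw [div_le_iff_of_neg h]
    have h1 : q * Real.log u + 1 ≤ u ^ q := by
      rw [Real.rpow_def_of_pos hu, mul_comm]
      exact Real.add_one_le_exp _
    nlinarith [Real.log_le_sub_one_of_pos hu]
  · rw [div_le_iff₀ h]
    have := rpow_one_add_le_one_add_mul_self (s := u - 1) (by linarith) h.le hq.le
    rw [add_sub_cancel] at this
    linarith

/-- The tangent line of the concave function `x ↦ x ^ q / q` at `y` lies above it. -/
lemma rpow_div_le_tangent {q x y : ℝ} (hq : q < 1) (hq0 : q ≠ 0) (hx : 0 < x) (hy : 0 < y) :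
    x ^ q / q ≤ y ^ q / q + y ^ (q - 1) * (x - y) := by
  have h := mul_le_mul_of_nonneg_left (rpow_sub_one_div_le hq hq0 (div_pos hx hy))
    (Real.rpow_pos_of_pos hy q).le
  rw [Real.div_rpow hx.le hy.le] at h
  have hyq := (Real.rpow_pos_of_pos hy q).ne'
  rw [Real.rpow_sub_one hy.ne']
  have e1 : y ^ q * ((x ^ q / y ^ q - 1) / q) = x ^ q / q - y ^ q / q := by field_simp
  have e2 : y ^ q * (x / y - 1) = y ^ q / y * (x - y) := by field_simp
  linarith

/-- Two-point Stroock–Varopoulos inequality below exponent one. -/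
lemma stroock_varopoulos_two_point {q x y : ℝ} (hq : q < 1) (hq0 : q ≠ 0)
    (hx : 0 < x) (hy : 0 < y) :
    4 * (1 - q) / q ^ 2 * (x ^ (q / 2) - y ^ (q / 2)) ^ 2
      ≤ -((x ^ (q - 1) - y ^ (q - 1)) * (x - y)) := by
  wlog hyx : y ≤ x generalizing x y
  · have := this hy hx (le_of_not_ge hyx)
    convert this using 1 <;> ring
  have key : ∀ l : ℝ, 0 ≤ (x ^ (q - 1) - y ^ (q - 1)) / (q - 1) * (l * l)
      + (-(4 / q * (x ^ (q / 2) - y ^ (q / 2)))) * l + (x - y) := by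
    intro l
    have hmono : MonotoneOn
        (fun s : ℝ => l ^ 2 * (s ^ (q - 1) / (q - 1)) - 4 / q * l * s ^ (q / 2) + s)
        (Set.Ioi 0) := by
      have hd : ∀ s ∈ Set.Ioi (0 : ℝ), HasDerivAt
          (fun s : ℝ => l ^ 2 * (s ^ (q - 1) / (q - 1)) - 4 / q * l * s ^ (q / 2) + s)
          ((l * s ^ (q / 2 - 1) - 1) ^ 2) s := by
        intro s hs
        have hs' : s ≠ 0 := (Set.mem_Ioi.mp hs).ne'
        have h := ((((Real.hasDerivAt_rpow_const (p := q - 1) (Or.inl hs')).div_const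
          (q - 1)).const_mul (l ^ 2)).sub ((Real.hasDerivAt_rpow_const (p := q / 2)
          (Or.inl hs')).const_mul (4 / q * l))).add (hasDerivAt_id s)
        refine h.congr_deriv ?_
        have e : s ^ (q - 1 - 1) = s ^ (q / 2 - 1) * s ^ (q / 2 - 1) := by
          rw [← Real.rpow_add hs]; ring_nf
        have : q - 1 ≠ 0 := by linarith
        rw [e]
        field_simp
        ring
      apply monotoneOn_of_deriv_nonneg (convex_Ioi 0)
      · exact fun s hs => (hd s hs).continuousAt.continuousWithinAt
      · rw [interior_Ioi]
        exact fun s hs => (hd s hs).differentiableAt.differentiableWithinAt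
      · rw [interior_Ioi]
        intro s hs
        rw [(hd s hs).deriv]
        positivity
    have := hmono hy hx hyx
    simp only at this
    have e : (x ^ (q - 1) - y ^ (q - 1)) / (q - 1) * (l * l)
      + (-(4 / q * (x ^ (q / 2) - y ^ (q / 2)))) * l + (x - y) =
      (l ^ 2 * (x ^ (q - 1) / (q - 1)) - 4 / q * l * x ^ (q / 2) + x) -
      (l ^ 2 * (y ^ (q - 1) / (q - 1)) - 4 / q * l * y ^ (q / 2) + y) := by ring
    linarith
  have hdisc := discrim_le_zero key
  rw [discrim] at hdisc
  have h1q : 0 < 1 - q := by linarith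
  have h2 : q - 1 ≠ 0 := by linarith
  have e : 4 * (1 - q) / q ^ 2 * (x ^ (q / 2) - y ^ (q / 2)) ^ 2
      + (x ^ (q - 1) - y ^ (q - 1)) * (x - y) = (1 - q) / 4 *
      ((-(4 / q * (x ^ (q / 2) - y ^ (q / 2)))) ^ 2 -
        4 * ((x ^ (q - 1) - y ^ (q - 1)) / (q - 1)) * (x - y)) := by
    field_simp
    ring
  nlinarith

/-- For a symmetric matrix with vanishing row sums, the bilinear form is a sum of products of
differences. -/
lemma sum_mul_mul_eq_neg_half {ι : Type*} [Fintype ι] {K : ι → ι → ℝ}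
    (hsymm : ∀ i j, K i j = K j i) (hrow : ∀ i, ∑ j, K i j = 0) (φ ψ : ι → ℝ) :
    ∑ i, ∑ j, K i j * φ i * ψ j
      = -(1 / 2) * ∑ i, ∑ j, K i j * ((φ i - φ j) * (ψ i - ψ j)) := by
  have h1 : ∑ i, ∑ j, K i j * (φ i * ψ i) = 0 := by
    simp [← Finset.sum_mul, hrow]
  have h2 : ∑ i, ∑ j, K i j * (φ j * ψ j) = 0 := by
    rw [Finset.sum_comm]
    simp_rw [← Finset.sum_mul]
    refine Finset.sum_eq_zero fun j _ => ?_
    have : ∑ i, K i j = 0 := by simpa only [hsymm _ j] using hrow j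
    rw [this, zero_mul]
  have h3 : ∑ i, ∑ j, K i j * φ j * ψ i = ∑ i, ∑ j, K i j * φ i * ψ j := by
    rw [Finset.sum_comm]
    refine Finset.sum_congr rfl fun i _ => Finset.sum_congr rfl fun j _ => ?_
    rw [hsymm]
  have h4 : ∑ i, ∑ j, K i j * ((φ i - φ j) * (ψ i - ψ j)) =
      ∑ i, ∑ j, K i j * (φ i * ψ i) + ∑ i, ∑ j, K i j * (φ j * ψ j)
        - ∑ i, ∑ j, K i j * φ j * ψ i - ∑ i, ∑ j, K i j * φ i * ψ j := by
    simp only [← Finset.sum_add_distrib, ← Finset.sum_sub_distrib]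
    refine Finset.sum_congr rfl fun i _ => Finset.sum_congr rfl fun j _ => ?_
    ring
  rw [h4, h1, h2, h3]
  ring

/-- Stroock–Varopoulos inequality for the generator of a symmetric Markov chain. -/
lemma stroock_varopoulos {ι : Type*} [Fintype ι] {K : ι → ι → ℝ}
    (hsymm : ∀ i j, K i j = K j i) (hrow : ∀ i, ∑ j, K i j = 0)
    (hoff : ∀ i j, i ≠ j → K i j ≤ 0) {q : ℝ} (hq : q < 1) (hq0 : q ≠ 0)
    {b : ι → ℝ} (hb : ∀ i, 0 < b i) :
    4 * (1 - q) / q ^ 2 * ∑ i, ∑ j, K i j * b i ^ (q / 2) * b j ^ (q / 2)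
      ≤ -∑ i, ∑ j, K i j * b i ^ (q - 1) * b j := by
  rw [sum_mul_mul_eq_neg_half hsymm hrow (fun i => b i ^ (q / 2)),
    sum_mul_mul_eq_neg_half hsymm hrow (fun i => b i ^ (q - 1)) b]
  have : ∑ i, ∑ j, K i j * -((b i ^ (q - 1) - b j ^ (q - 1)) * (b i - b j)) ≤
      ∑ i, ∑ j, K i j * (4 * (1 - q) / q ^ 2 * (b i ^ (q / 2) - b j ^ (q / 2)) ^ 2) := by
    refine Finset.sum_le_sum fun i _ => Finset.sum_le_sum fun j _ => ?_
    by_cases hij : i = j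
    · simp [hij]
    · exact mul_le_mul_of_nonpos_left
        (stroock_varopoulos_two_point hq hq0 (hb i) (hb j)) (hoff i j hij)
  have e1 : ∑ i, ∑ j, K i j * -((b i ^ (q - 1) - b j ^ (q - 1)) * (b i - b j)) =
      -∑ i, ∑ j, K i j * ((b i ^ (q - 1) - b j ^ (q - 1)) * (b i - b j)) := by
    simp only [← Finset.sum_neg_distrib, mul_neg]
  have e2 : ∑ i, ∑ j, K i j * (4 * (1 - q) / q ^ 2 * (b i ^ (q / 2) - b j ^ (q / 2)) ^ 2) =
      4 * (1 - q) / q ^ 2 * ∑ i, ∑ j, K i j *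
        ((b i ^ (q / 2) - b j ^ (q / 2)) * (b i ^ (q / 2) - b j ^ (q / 2))) := by
    simp only [Finset.mul_sum]
    refine Finset.sum_congr rfl fun i _ => Finset.sum_congr rfl fun j _ => ?_
    ring
  rw [e1, e2] at this
  linarith

lemma sum_markov_nonneg {ι : Type*} [Fintype ι] {K : ι → ι → ℝ}
    (hsymm : ∀ i j, K i j = K j i) (hrow : ∀ i, ∑ j, K i j = 0)
    (hoff : ∀ i j, i ≠ j → K i j ≤ 0) (φ : ι → ℝ) :
    0 ≤ ∑ i, ∑ j, K i j * φ i * φ j := by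
  rw [sum_mul_mul_eq_neg_half hsymm hrow]
  have : ∑ i, ∑ j, K i j * ((φ i - φ j) * (φ i - φ j)) ≤ 0 := by
    refine Finset.sum_nonpos fun i _ => Finset.sum_nonpos fun j _ => ?_
    by_cases hij : i = j
    · simp [hij]
    · exact mul_nonpos_of_nonpos_of_nonneg (hoff i j hij) (mul_self_nonneg _)
  linarith

open Filter Topology in
/-- A function that is lower semicontinuous from the right in the sense `hright` and has
nonnegative lower left Dini derivative satisfies `g a ≤ g b`. -/
lemma le_of_left_dini_nonneg {g : ℝ → ℝ} {a b : ℝ} (hab : a ≤ b)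
    (hleft : ∀ x ∈ Set.Ioc a b, ∀ r > 0, ∀ᶠ s in 𝓝[<] x, g s ≤ g x + r * (x - s))
    (hright : ∀ x ∈ Set.Ico a b, ∀ ε > 0, ∀ᶠ s in 𝓝[>] x, g x ≤ g s + ε) :
    g a ≤ g b := by
  have key : ∀ r > 0, g a ≤ g b + r * (b - a) := by
    intro r hr
    set S := {s | s ∈ Set.Icc a b ∧ g s ≤ g b + r * (b - s)} with hS
    have hbS : b ∈ S := ⟨⟨hab, le_rfl⟩, by simp⟩
    have hbdd : BddBelow S := ⟨a, fun s hs => hs.1.1⟩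
    set c := sInf S with hc
    have hac : a ≤ c := le_csInf ⟨b, hbS⟩ fun s hs => hs.1.1
    have hcb : c ≤ b := csInf_le hbdd hbS
    have hcS : c ∈ S := by
      by_contra hcS
      have hcb' : c < b := lt_of_le_of_ne hcb fun h => hcS (h ▸ hbS)
      refine hcS ⟨⟨hac, hcb⟩, le_of_forall_pos_le_add fun ε hε => ?_⟩
      obtain ⟨u, hu, hu'⟩ := (mem_nhdsGT_iff_exists_Ioo_subset).mp (hright c ⟨hac, hcb'⟩ ε hε)
      obtain ⟨s, hsS, hsu⟩ := exists_lt_of_csInf_lt ⟨b, hbS⟩ (show sInf S < u from hu)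
      have hcs : c < s := lt_of_le_of_ne (csInf_le hbdd hsS) fun h => hcS (h ▸ hsS)
      have h1 : g c ≤ g s + ε := hu' ⟨hcs, hsu⟩
      have h2 := hsS.2
      nlinarith
    rcases hac.eq_or_lt with h | h
    · rw [h]; exact hcS.2
    · exfalso
      have hev := (hleft c ⟨h, hcb⟩ r hr).and (Ioo_mem_nhdsLT h)
      obtain ⟨s, hs, hs'⟩ := hev.exists
      have : s ∈ S := ⟨⟨hs'.1.le, hs'.2.le.trans hcb⟩, by linarith [hcS.2]⟩
      linarith [csInf_le hbdd this, hs'.2]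
  refine le_of_forall_pos_le_add fun ε hε => ?_
  have h := key (ε / (b - a + 1)) (by apply div_pos hε; linarith)
  have : ε / (b - a + 1) * (b - a) ≤ ε := by
    rw [div_mul_eq_mul_div, div_le_iff₀ (by linarith)]
    nlinarith
  linarith

/-- The normalized power sum of a finite family of real numbers. -/
noncomputable def powMean {ι : Type*} [Fintype ι] (r : ℝ) (b : ι → ℝ) : ℝ :=
  (∑ i, b i ^ r) / Fintype.card ι

/-- The logarithm of the normalized `ℓ_r` norm, extended to `r = 0` by continuity. -/
noncomputable def logNorm {ι : Type*} [Fintype ι] (r : ℝ) (b : ι → ℝ) : ℝ :=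
  dslope (fun s => Real.log (powMean s b)) 0 r

lemma hasDerivAt_powMean {ι : Type*} [Fintype ι] {x q' : ℝ} {Q : ℝ → ℝ} {β : ℝ → ι → ℝ}
    {β' : ι → ℝ}
    (hβ : ∀ i, 0 < β x i) (hQ : HasDerivAt Q q' x)
    (hβ' : ∀ i, HasDerivAt (fun s => β s i) (β' i) x) :
    HasDerivAt (fun s => powMean (Q s) (β s))
      ((∑ i, (β' i * Q x * β x i ^ (Q x - 1) + q' * β x i ^ Q x * Real.log (β x i)))
        / Fintype.card ι) x := by
  have := HasDerivAt.sum (u := Finset.univ) fun i _ => (hβ' i).rpow hQ (hβ i)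
  simpa only [powMean, Finset.sum_fn] using this.div_const _

section PowMean

variable {ι : Type*} [Fintype ι] [Nonempty ι]

lemma powMean_pos {b : ι → ℝ} (hb : ∀ i, 0 < b i) (r : ℝ) : 0 < powMean r b :=
  div_pos (Finset.sum_pos (fun i _ => Real.rpow_pos_of_pos (hb i) r) Finset.univ_nonempty)
    (by exact_mod_cast Fintype.card_pos)

lemma logNorm_of_ne {r : ℝ} (hr : r ≠ 0) (b : ι → ℝ) :
    logNorm r b = Real.log (powMean r b) / r := by
  have h : powMean 0 b = 1 := by simp [powMean]
  rw [logNorm, dslope_of_ne _ hr, slope_def_field, h]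
  simp

lemma continuous_logNorm {b : ι → ℝ} (hb : ∀ i, 0 < b i) : Continuous fun r => logNorm r b := by
  have hd : ∀ r, DifferentiableAt ℝ (fun s => Real.log (powMean s b)) r := fun r =>
    ((hasDerivAt_powMean (β := fun _ => b) (x := r) hb (hasDerivAt_id r)
      fun i => hasDerivAt_const r (b i)).log (powMean_pos hb r).ne').differentiableAt
  rw [continuous_iff_continuousAt]
  intro r
  rcases eq_or_ne r 0 with rfl | h
  · exact continuousAt_dslope_same.mpr (hd 0)
  · exact (continuousAt_dslope_of_ne h).mpr (hd r).continuousAt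

lemma log_powMean_div_mono {r : ℝ} (hr : r ≠ 0) {a b : ι → ℝ} (ha : ∀ i, 0 < a i)
    (hb : ∀ i, 0 < b i) (h : powMean r a / r ≤ powMean r b / r) :
    logNorm r a ≤ logNorm r b := by
  rw [logNorm_of_ne hr, logNorm_of_ne hr]
  rcases lt_or_gt_of_ne hr with h' | h'
  · rw [div_le_div_right_of_neg h'] at h ⊢
    exact Real.log_le_log (powMean_pos hb r) h
  · rw [div_le_div_iff_of_pos_right h'] at h ⊢
    exact Real.log_le_log (powMean_pos ha r) h

lemma logNorm_const_mul {r : ℝ} (hr : r ≠ 0) {b : ι → ℝ} (hb : ∀ i, 0 < b i) {c : ℝ}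
    (hc : 0 < c) : logNorm r (fun i => c * b i) = logNorm r b + Real.log c := by
  have : powMean r (fun i => c * b i) = c ^ r * powMean r b := by
    simp only [powMean, Real.mul_rpow hc.le (hb _).le, ← Finset.mul_sum, mul_div_assoc]
  rw [logNorm_of_ne hr, logNorm_of_ne hr, this,
    Real.log_mul (Real.rpow_pos_of_pos hc r).ne' (powMean_pos hb r).ne', Real.log_rpow hc]
  field_simp
  ring

lemma logNorm_mono {r : ℝ} (hr : r ≠ 0) {a b : ι → ℝ} (ha : ∀ i, 0 < a i)
    (h : ∀ i, a i ≤ b i) : logNorm r a ≤ logNorm r b := by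
  have hb : ∀ i, 0 < b i := fun i => (ha i).trans_le (h i)
  refine log_powMean_div_mono hr ha hb ?_
  rw [powMean, powMean]
  rcases lt_or_gt_of_ne hr with h' | h'
  · rw [div_le_div_right_of_neg h']
    exact div_le_div_of_nonneg_right (Finset.sum_le_sum fun i _ =>
      Real.rpow_le_rpow_of_nonpos (ha i) (h i) h'.le) (Nat.cast_nonneg _)
  · gcongr with i
    exacts [(ha i).le, h i]

/-- Doubly stochastic averaging increases the `ℓ_q` norm for `q < 1`. -/
lemma logNorm_le_of_doublyStochastic {q : ℝ} (hq : q < 1) (hq0 : q ≠ 0) {a β : ι → ℝ}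
    (ha : ∀ i, 0 < a i) (hβ : ∀ i, 0 < β i) {w : ι → ι → ℝ} (hw : ∀ j i, 0 ≤ w j i)
    (hrow : ∀ j, ∑ i, w j i = 1) (hcol : ∀ i, ∑ j, w j i = 1)
    (hmean : ∀ j, β j = ∑ i, w j i * a i) :
    logNorm q a ≤ logNorm q β := by
  refine log_powMean_div_mono hq0 ha hβ ?_
  have hj : ∀ j, ∑ i, w j i * (a i ^ q / q) ≤ β j ^ q / q := by
    intro j
    have h1 : ∑ i, w j i * (a i ^ q / q) ≤
        ∑ i, w j i * (β j ^ q / q + β j ^ (q - 1) * (a i - β j)) :=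
      Finset.sum_le_sum fun i _ =>
        mul_le_mul_of_nonneg_left (rpow_div_le_tangent hq hq0 (ha i) (hβ j)) (hw j i)
    have h2 : ∑ i, w j i * (β j ^ q / q + β j ^ (q - 1) * (a i - β j)) =
        (∑ i, w j i) * (β j ^ q / q) +
          β j ^ (q - 1) * (∑ i, w j i * a i - (∑ i, w j i) * β j) := by
      simp only [Finset.sum_mul, Finset.mul_sum, mul_sub, ← Finset.sum_add_distrib,
        ← Finset.sum_sub_distrib]
      refine Finset.sum_congr rfl fun i _ => ?_
      ring
    rw [h2, ← hmean, hrow] at h1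
    linarith
  have hsum := Finset.sum_le_sum fun j (_ : j ∈ Finset.univ) => hj j
  rw [Finset.sum_comm] at hsum
  simp only [← Finset.sum_mul, hcol, one_mul, ← Finset.sum_div] at hsum
  rw [powMean, powMean, div_right_comm, div_right_comm (∑ i, β i ^ q)]
  gcongr

/-- The logarithmic norm has nonnegative derivative along a symmetric Markov flow satisfying the
log-Sobolev inequality, when the exponent decreases at most at the critical rate. -/
lemma exists_hasDerivAt_logNorm_nonneg {K : ι → ι → ℝ}
    (hsymm : ∀ i j, K i j = K j i) (hrow : ∀ i, ∑ j, K i j = 0)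
    (hoff : ∀ i j, i ≠ j → K i j ≤ 0) {α κ x : ℝ} (hα : 0 < α) (hκ : 0 ≤ κ) (hκα : κ ≤ 4 / α)
    {Q : ℝ → ℝ} {β : ℝ → ι → ℝ} (hq : Q x < 1) (hq0 : Q x ≠ 0) (hβ : ∀ i, 0 < β x i)
    (hQ : HasDerivAt Q (-(κ * (1 - Q x))) x)
    (hβ' : ∀ i, HasDerivAt (fun s => β s i) (-∑ j, K i j * β x j) x)
    (hLSI : (∑ i, β x i ^ Q x * Real.log (β x i ^ Q x)) / Fintype.card ι
        - powMean (Q x) (β x) * Real.log (powMean (Q x) (β x))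
      ≤ α * ((∑ i, ∑ j, K i j * β x i ^ (Q x / 2) * β x j ^ (Q x / 2)) / Fintype.card ι)) :
    ∃ D, 0 ≤ D ∧ HasDerivAt (fun s => Real.log (powMean (Q s) (β s)) / Q s) D x := by
  have hN := powMean_pos hβ (Q x)
  refine ⟨_, ?_, ((hasDerivAt_powMean hβ hQ hβ').log hN.ne').div hQ hq0⟩
  have hSV := stroock_varopoulos hsymm hrow hoff hq hq0 hβ
  have hE := sum_markov_nonneg hsymm hrow hoff (fun i => β x i ^ (Q x / 2))
  set N := powMean (Q x) (β x) with hNdef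
  set E := ∑ i, ∑ j, K i j * β x i ^ (Q x / 2) * β x j ^ (Q x / 2)
  set F := ∑ i, ∑ j, K i j * β x i ^ (Q x - 1) * β x j with hF
  set q := Q x
  set n : ℝ := ((Fintype.card ι : ℕ) : ℝ)
  have hn : 0 < n := by simpa [n] using Fintype.card_pos
  set B := ∑ i, β x i ^ q * Real.log (β x i) with hB
  have hlog : ∑ i, β x i ^ q * Real.log (β x i ^ q) = q * B := by
    rw [hB, Finset.mul_sum]
    refine Finset.sum_congr rfl fun i _ => ?_
    rw [Real.log_rpow (hβ i)]
    ring
  have hsum : ∑ i, (-(∑ j, K i j * β x j) * q * β x i ^ (q - 1)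
      + -(κ * (1 - q)) * β x i ^ q * Real.log (β x i)) = q * -F + -(κ * (1 - q)) * B := by
    rw [Finset.sum_add_distrib, hF, hB, ← Finset.sum_neg_distrib, Finset.mul_sum, Finset.mul_sum]
    congr 1
    · refine Finset.sum_congr rfl fun i _ => ?_
      have : ∑ j, K i j * β x i ^ (q - 1) * β x j =
          (∑ j, K i j * β x j) * β x i ^ (q - 1) := by
        rw [Finset.sum_mul]
        exact Finset.sum_congr rfl fun j _ => by ring
      rw [this]; ring
    · exact Finset.sum_congr rfl fun i _ => by ring
  rw [hlog] at hLSI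
  rw [hsum]
  apply div_nonneg _ (sq_nonneg q)
  have h1q : 0 < 1 - q := by linarith
  have e : (q * -F + -(κ * (1 - q)) * B) / n / N * q - Real.log N * -(κ * (1 - q)) =
      (q ^ 2 * -F / n - κ * (1 - q) * (q * B / n - N * Real.log N)) / N := by
    field_simp
    ring
  rw [e]
  apply div_nonneg _ hN.le
  have h1 : κ * (1 - q) * (q * B / n - N * Real.log N) ≤ κ * (1 - q) * (α * (E / n)) :=
    mul_le_mul_of_nonneg_left hLSI (by positivity)
  have h2 : κ * (1 - q) * (α * (E / n)) ≤ 4 * (1 - q) * (E / n) := by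
    have : κ * α ≤ 4 := (le_div_iff₀ hα).mp hκα
    have h3 : 0 ≤ (1 - q) * (E / n) := by positivity
    nlinarith
  have h3 : 4 * (1 - q) * (E / n) ≤ q ^ 2 * -F / n := by
    rw [mul_div_assoc', div_le_div_iff_of_pos_right hn]
    have hq2 : 0 < q ^ 2 := by positivity
    calc 4 * (1 - q) * E = q ^ 2 * (4 * (1 - q) / q ^ 2 * E) := by field_simp
      _ ≤ _ := mul_le_mul_of_nonneg_left hSV hq2.le
  linarith

end PowMean

section Semigroup

open NormedSpace

variable {E : Type*} [NormedAddCommGroup E] [NormedSpace ℂ E]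

lemma hasSum_exp_smul_apply [CompleteSpace E] (A : E →L[ℂ] E) (t : ℝ) (f : E) :
    HasSum (fun k : ℕ => ((t ^ k / (Nat.factorial k) : ℝ) : ℂ) • A^[k] f) (exp (t • A) f) := by
  have h := (exp_series_hasSum_exp' (𝕂 := ℝ) (t • A)).mapL
    (ContinuousLinearMap.apply ℂ E f)
  convert h using 2
  · rw [smul_pow, smul_smul, ContinuousLinearMap.apply_apply, FunLike.coe_smul,
      Pi.smul_apply, FunLike.coe_pow_eq_iterate, Complex.coe_smul, div_eq_inv_mul]
  · rfl

lemma exp_neg_smul_smul_one_sub [CompleteSpace E] (A : E →L[ℂ] E) (c t : ℝ) :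
    exp ((-t) • (c • (1 - A))) = Real.exp (-(c * t)) • exp ((c * t) • A) := by
  let _ := NormedAlgebra.restrictScalars ℚ ℝ (E →L[ℂ] E)
  have e : (-t) • (c • (1 - A)) = algebraMap ℝ (E →L[ℂ] E) (-(c * t)) + (c * t) • A := by
    rw [Algebra.algebraMap_eq_smul_one]
    module
  rw [e, NormedSpace.exp_add_of_commute (Algebra.commutes _ _), ← algebraMap_exp_comm,
    ← Real.exp_eq_exp_ℝ, Algebra.smul_def (Real.exp _)]

/-- The properties of the semigroup `exp (-t c (1 - T))` on a finite-dimensional space, phrased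
through its power series. -/
lemma semigroup_properties [FiniteDimensional ℂ E] (T : E →ₗ[ℂ] E) (c : ℝ) (L : E → E)
    (hL : L = fun g => (c : ℂ) • (g - T g)) (S : ℝ → E → E)
    (hS : S = fun t f => ∑' k : ℕ, (((-t) ^ k / (Nat.factorial k) : ℝ) : ℂ) • L^[k] f) :
    (∀ t f, HasSum (fun k : ℕ => (((-t) ^ k / (Nat.factorial k) : ℝ) : ℂ) • L^[k] f) (S t f)) ∧
    (∀ t f, HasSum (fun k : ℕ =>
      ((Real.exp (-(c * t)) * ((c * t) ^ k / (Nat.factorial k)) : ℝ) : ℂ) • T^[k] f) (S t f)) ∧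
    (∀ s t f, S (s + t) f = S s (S t f)) ∧
    (∀ t f g, S t (f + g) = S t f + S t g) ∧
    (∀ (ℓ : E →ₗ[ℂ] ℂ) t f,
      HasDerivAt (fun s => (ℓ (S s f)).re) (-(ℓ (L (S t f))).re) t) := by
  have : CompleteSpace E := FiniteDimensional.complete ℂ E
  let _ := NormedAlgebra.restrictScalars ℚ ℝ (E →L[ℂ] E)
  set A : E →L[ℂ] E := LinearMap.toContinuousLinearMap T with hA
  have hLA : L = ⇑(c • (1 - A)) := by
    rw [hL]
    ext g
    simp [hA]
  have hSum : ∀ t f, HasSum (fun k : ℕ => (((-t) ^ k / (Nat.factorial k) : ℝ) : ℂ) • L^[k] f)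
      (exp ((-t) • (c • (1 - A))) f) := by
    intro t f
    rw [hLA]
    exact hasSum_exp_smul_apply _ _ _
  have hSe : ∀ t f, S t f = exp ((-t) • (c • (1 - A))) f := by
    intro t f
    rw [hS]
    exact (hSum t f).tsum_eq
  refine ⟨fun t f => hSe t f ▸ hSum t f, fun t f => ?_, fun s t f => ?_, fun t f g => ?_,
    fun ℓ t f => ?_⟩
  · rw [hSe, exp_neg_smul_smul_one_sub]
    have h := (hasSum_exp_smul_apply A (c * t) f).const_smul ((Real.exp (-(c * t)) : ℝ) : ℂ)
    simp only [smul_smul, ← Complex.ofReal_mul] at h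
    exact h
  · have e : (-(s + t)) • (c • (1 - A)) = (-s) • (c • (1 - A)) + (-t) • (c • (1 - A)) := by
      module
    rw [hSe, hSe, hSe, e, NormedSpace.exp_add_of_commute]
    · rfl
    · exact (Commute.refl _).smul_left _ |>.smul_right _
  · simp only [hSe, map_add]
  · have h := (hasDerivAt_exp_smul_const' (𝕂 := ℝ) (-(c • (1 - A))) t)
    let φ : (E →L[ℂ] E) →L[ℝ] ℝ := Complex.reCLM.comp
      (((LinearMap.toContinuousLinearMap ℓ).comp
        (ContinuousLinearMap.apply ℂ E f)).restrictScalars ℝ)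
    have h2 := φ.hasFDerivAt.comp_hasDerivAt t h
    have hφ : ∀ B, φ B = (ℓ (B f)).re := fun B => rfl
    have e : (fun s => (ℓ (S s f)).re) = φ ∘ fun u => exp (u • -(c • (1 - A))) := by
      ext s
      rw [hSe, Function.comp_apply, hφ, smul_neg, neg_smul]
    rw [e]
    refine h2.congr_deriv ?_
    rw [hφ, hLA, hSe, neg_mul, smul_neg, neg_smul, ← Complex.neg_re, ← map_neg]
    rfl

end Semigroup

lemma opExp_properties {ι : Type*} [Fintype ι] [DecidableEq ι]
    {T L : Matrix ι ι ℂ → Matrix ι ι ℂ}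
    (hT : IsLinearMap ℂ T) {c : ℝ} (hL : L = fun g => (c : ℂ) • (g - T g)) :
    (∀ t f, HasSum (fun k : ℕ => (((-t) ^ k / (Nat.factorial k) : ℝ) : ℂ) • L^[k] f)
      (opExp L t f)) ∧
    (∀ t f, HasSum (fun k : ℕ =>
      ((Real.exp (-(c * t)) * ((c * t) ^ k / (Nat.factorial k)) : ℝ) : ℂ) • T^[k] f)
      (opExp L t f)) ∧
    (∀ s t f, opExp L (s + t) f = opExp L s (opExp L t f)) ∧
    (∀ t f g, opExp L t (f + g) = opExp L t f + opExp L t g) ∧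
    (∀ (ℓ : Matrix ι ι ℂ →ₗ[ℂ] ℂ) t f,
      HasDerivAt (fun s => (ℓ (opExp L s f)).re) (-(ℓ (L (opExp L t f))).re) t) :=
  semigroup_properties (E := ι → ι → ℂ) (hT.mk' T) c L hL (opExp L) rfl

section Spectral

variable {ι : Type*} [Fintype ι] [DecidableEq ι]

lemma hermFC_eq_cfc {A : Matrix ι ι ℂ} (hA : A.IsHermitian) (φ : ℝ → ℝ) :
    hermFC φ A = cfc φ A := by
  rw [hermFC, dif_pos hA, hA.cfc_eq, Matrix.IsHermitian.cfc, Unitary.conjStarAlgAut_apply]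
  rfl

lemma continuousOn_spectrum (A : Matrix ι ι ℂ) (φ : ℝ → ℝ) : ContinuousOn φ (spectrum ℝ A) :=
  A.finite_real_spectrum.continuousOn φ

lemma isHermitian_hermFC {A : Matrix ι ι ℂ} (hA : A.IsHermitian) (φ : ℝ → ℝ) :
    (hermFC φ A).IsHermitian := by
  rw [hermFC_eq_cfc hA]
  exact cfc_predicate φ A

lemma hermFC_hermFC {A : Matrix ι ι ℂ} (hA : A.IsHermitian) (φ ψ : ℝ → ℝ) :
    hermFC φ (hermFC ψ A) = hermFC (fun x => φ (ψ x)) A := by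
  rw [hermFC_eq_cfc (isHermitian_hermFC hA ψ), hermFC_eq_cfc hA, hermFC_eq_cfc hA]
  exact (cfc_comp φ ψ A hA ((A.finite_real_spectrum.image ψ).continuousOn φ)
    (continuousOn_spectrum A ψ)).symm

lemma hermFC_mul_hermFC {A : Matrix ι ι ℂ} (hA : A.IsHermitian) (φ ψ : ℝ → ℝ) :
    hermFC φ A * hermFC ψ A = hermFC (fun x => φ x * ψ x) A := by
  rw [hermFC_eq_cfc hA, hermFC_eq_cfc hA, hermFC_eq_cfc hA]
  exact (cfc_mul φ ψ A (continuousOn_spectrum A φ) (continuousOn_spectrum A ψ)).symm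

lemma hermFC_id {A : Matrix ι ι ℂ} (hA : A.IsHermitian) : hermFC (fun x => x) A = A := by
  rw [hermFC_eq_cfc hA]
  exact cfc_id' ℝ A

lemma trace_hermFC {A : Matrix ι ι ℂ} (hA : A.IsHermitian) (φ : ℝ → ℝ) :
    (hermFC φ A).trace = ∑ i, (φ (hA.eigenvalues i) : ℂ) := by
  rw [hermFC, dif_pos hA, Matrix.trace_mul_comm, ← mul_assoc, Unitary.coe_star_mul_self, one_mul,
    Matrix.trace_diagonal]

lemma ntrace_hermFC {A : Matrix ι ι ℂ} (hA : A.IsHermitian) (φ : ℝ → ℝ) :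
    ntrace (hermFC φ A) = (∑ i, φ (hA.eigenvalues i)) / Fintype.card ι := by
  rw [ntrace, trace_hermFC hA, ← Complex.ofReal_sum, Complex.ofReal_re]

lemma snorm_hermFC {A : Matrix ι ι ℂ} (hA : A.IsHermitian) (φ : ℝ → ℝ) (p : ℝ) :
    snorm p (hermFC φ A) = powMean p (fun i => |φ (hA.eigenvalues i)|) ^ (1 / p) := by
  rw [snorm, mpow, (isHermitian_hermFC hA φ).eq, hermFC_mul_hermFC hA, hermFC_hermFC hA,
    ntrace_hermFC hA, powMean]
  congr 2
  refine Finset.sum_congr rfl fun i _ => ?_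
  rw [← abs_mul_abs_self, ← sq, ← Real.rpow_natCast, ← Real.rpow_mul (abs_nonneg _)]
  congr 1
  push_cast
  ring

lemma snorm_eq {A : Matrix ι ι ℂ} (hA : A.IsHermitian) (p : ℝ) :
    snorm p A = powMean p (fun i => |hA.eigenvalues i|) ^ (1 / p) := by
  conv_lhs => rw [← hermFC_id hA]
  exact snorm_hermFC hA _ p

lemma snorm_eq_of_posSemidef {A : Matrix ι ι ℂ} (hA : A.PosSemidef) (p : ℝ) :
    snorm p A = powMean p hA.isHermitian.eigenvalues ^ (1 / p) := by
  simp only [snorm_eq hA.isHermitian, abs_of_nonneg (hA.eigenvalues_nonneg _)]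

/-- The real diagonal of `B` in the orthonormal basis given by the columns of `V`. -/
noncomputable def diagIn (V : Matrix ι ι ℂ) (B : Matrix ι ι ℂ) (j : ι) : ℝ :=
  ((star V * B * V) j j).re

lemma diagIn_nonneg {ι : Type*} [Fintype ι] (V : Matrix ι ι ℂ) {B : Matrix ι ι ℂ}
    (hB : B.PosSemidef) (j : ι) : 0 ≤ diagIn V B j :=
  (Complex.le_def.mp ((hB.conjTranspose_mul_mul_same V).diag_nonneg (i := j))).1

/-- The rank-one projection onto the `i`-th column of `V`. -/
def colProj (V : Matrix ι ι ℂ) (i : ι) : Matrix ι ι ℂ := V * Matrix.single i i 1 * star V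

lemma trace_colProj_mul (V B : Matrix ι ι ℂ) (i : ι) :
    (colProj V i * B).trace = (star V * B * V) i i := by
  rw [colProj, mul_assoc, mul_assoc, Matrix.trace_mul_comm, mul_assoc, Matrix.trace_single_mul,
    one_smul]

lemma diagIn_eq_trace (V B : Matrix ι ι ℂ) (i : ι) :
    diagIn V B i = ((colProj V i * B).trace).re := by
  rw [trace_colProj_mul, diagIn]

lemma posSemidef_colProj (V : Matrix ι ι ℂ) (i : ι) : (colProj V i).PosSemidef := by
  have h : (Matrix.single i i (1 : ℂ)).PosSemidef := by
    rw [← Matrix.diagonal_single]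
    exact Matrix.PosSemidef.diagonal (Pi.single_nonneg.mpr zero_le_one)
  exact h.mul_mul_conjTranspose_same V

lemma diagIn_pos (V : Matrix.unitaryGroup ι ℂ) {B : Matrix ι ι ℂ} (hB : B.PosDef) (j : ι) :
    0 < diagIn V B j := by
  have hV : Function.Injective (V : Matrix ι ι ℂ).mulVec :=
    Matrix.mulVec_injective_of_isUnit (Unitary.toUnits V).isUnit
  exact (Complex.lt_def.mp ((hB.conjTranspose_mul_mul_same hV).diag_pos (i := j))).1

lemma sum_colProj (V : Matrix.unitaryGroup ι ℂ) : ∑ i, colProj (V : Matrix ι ι ℂ) i = 1 := by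
  simp only [colProj, ← Finset.sum_mul, ← Finset.mul_sum]
  have : ∑ i : ι, Matrix.single i i (1 : ℂ) = 1 := by
    ext a b
    simp [Matrix.sum_apply, Matrix.single_apply, Matrix.one_apply, ite_and]
  rw [this, mul_one]
  exact Unitary.mul_star_self_of_mem V.2

lemma colProj_mul_colProj (V : Matrix.unitaryGroup ι ℂ) {i j : ι} (hij : i ≠ j) :
    colProj (V : Matrix ι ι ℂ) i * colProj (V : Matrix ι ι ℂ) j = 0 := by
  have e : colProj (V : Matrix ι ι ℂ) i * colProj (V : Matrix ι ι ℂ) j =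
      (V : Matrix ι ι ℂ) * (Matrix.single i i (1 : ℂ) *
        (star (V : Matrix ι ι ℂ) * (V : Matrix ι ι ℂ)) * Matrix.single j j 1) *
          star (V : Matrix ι ι ℂ) := by
    simp only [colProj, mul_assoc]
  rw [e, Unitary.star_mul_self_of_mem V.2, mul_one, Matrix.single_mul_single_of_ne _ _ _ _ hij]
  simp

lemma hermFC_eq_sum {A : Matrix ι ι ℂ} (hA : A.IsHermitian) (φ : ℝ → ℝ) :
    hermFC φ A = ∑ i, (φ (hA.eigenvalues i) : ℂ) •
      colProj (hA.eigenvectorUnitary : Matrix ι ι ℂ) i := by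
  rw [hermFC, dif_pos hA]
  have : Matrix.diagonal (fun i => (φ (hA.eigenvalues i) : ℂ)) =
      ∑ i, (φ (hA.eigenvalues i) : ℂ) • Matrix.single i i (1 : ℂ) := by
    ext a b
    simp [Matrix.sum_apply, Matrix.single_apply, Matrix.diagonal_apply, ite_and]
  rw [this, Finset.mul_sum, Finset.sum_mul]
  refine Finset.sum_congr rfl fun i _ => ?_
  rw [mul_smul_comm, smul_mul_assoc, colProj]

lemma hermFC_add_const {A : Matrix ι ι ℂ} (hA : A.IsHermitian) (r : ℝ) :
    hermFC (fun x => x + r) A = A + (r : ℂ) • 1 := by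
  conv_rhs => rw [← hermFC_id hA]
  rw [hermFC_eq_sum hA, hermFC_eq_sum hA, ← sum_colProj hA.eigenvectorUnitary, Finset.smul_sum,
    ← Finset.sum_add_distrib]
  exact Finset.sum_congr rfl fun i _ => by rw [Complex.ofReal_add, add_smul]

lemma diagIn_eigenvectorUnitary {A : Matrix ι ι ℂ} (hA : A.IsHermitian) :
    diagIn (hA.eigenvectorUnitary : Matrix ι ι ℂ) A = hA.eigenvalues := by
  ext j
  have h := hA.conjStarAlgAut_star_eigenvectorUnitary
  rw [Unitary.conjStarAlgAut_star_apply] at h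
  rw [diagIn, h]
  simp

/-- A variational bound of Peierls type: for `q < 1`, the `ℓ_q` norm of the eigenvalues is at most
that of the diagonal in any orthonormal basis. -/
lemma logNorm_eigenvalues_le_diagIn [Nonempty ι] {q : ℝ} (hq : q < 1) (hq0 : q ≠ 0)
    {A : Matrix ι ι ℂ} (hA : A.PosDef) (V : Matrix.unitaryGroup ι ℂ) :
    logNorm q hA.isHermitian.eigenvalues ≤ logNorm q (diagIn V A) := by
  set U := hA.isHermitian.eigenvectorUnitary
  have hrow : ∀ (W : Matrix.unitaryGroup ι ℂ) (j : ι),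
      ∑ i, Complex.normSq ((W : Matrix ι ι ℂ) j i) = 1 := by
    intro W j
    have h := congrFun (congrFun (Unitary.coe_mul_star_self W) j) j
    rw [Matrix.mul_apply, Matrix.one_apply_eq] at h
    have h' : ((∑ i, Complex.normSq ((W : Matrix ι ι ℂ) j i) : ℝ) : ℂ) = 1 := by
      rw [← h, Complex.ofReal_sum]
      exact Finset.sum_congr rfl fun i _ => (Complex.mul_conj _).symm
    exact_mod_cast h'
  refine logNorm_le_of_doublyStochastic hq hq0 hA.eigenvalues_pos (diagIn_pos V hA)
    (w := fun j i => Complex.normSq (((star V * U : Matrix.unitaryGroup ι ℂ) : Matrix ι ι ℂ) j i))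
    (fun j i => Complex.normSq_nonneg _) (hrow _) ?_ ?_
  · intro i
    rw [← hrow (star (star V * U)) i]
    refine Finset.sum_congr rfl fun j _ => ?_
    rw [Unitary.coe_star, Matrix.star_apply]
    exact (Complex.normSq_conj _).symm
  · intro j
    set W : Matrix.unitaryGroup ι ℂ := star V * U
    have hsp : A = (U : Matrix ι ι ℂ) * Matrix.diagonal
        (fun i => (hA.isHermitian.eigenvalues i : ℂ)) * star (U : Matrix ι ι ℂ) := by
      conv_lhs => rw [hA.isHermitian.spectral_theorem, Unitary.conjStarAlgAut_apply]
      rfl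
    have h : star (V : Matrix ι ι ℂ) * A * V = (W : Matrix ι ι ℂ) * Matrix.diagonal
        (fun i => (hA.isHermitian.eigenvalues i : ℂ)) * star (W : Matrix ι ι ℂ) := by
      conv_lhs => rw [hsp]
      simp only [W, Submonoid.coe_mul, Unitary.coe_star, star_mul, star_star, mul_assoc]
    rw [diagIn, h, Matrix.mul_apply, Complex.re_sum]
    refine Finset.sum_congr rfl fun i _ => ?_
    rw [Matrix.mul_diagonal, Matrix.star_apply, mul_right_comm]
    rw [show star ((W : Matrix ι ι ℂ) j i) = starRingEnd ℂ ((W : Matrix ι ι ℂ) j i) from rfl,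
      Complex.mul_conj, ← Complex.ofReal_mul, Complex.ofReal_re]

end Spectral

section Channel

variable {ι : Type*} [Fintype ι] [DecidableEq ι]

lemma IsCompletelyPositive.posSemidef {T : Matrix ι ι ℂ → Matrix ι ι ℂ}
    (hT : IsCompletelyPositive T) {f : Matrix ι ι ℂ} (hf : f.PosSemidef) : (T f).PosSemidef :=
  (hT 1 (f.submatrix Prod.snd Prod.snd) (hf.submatrix _)).submatrix fun i => (0, i)

lemma isHermitian_map {T : Matrix ι ι ℂ → Matrix ι ι ℂ} (hT : IsLinearMap ℂ T)
    (hpos : ∀ f : Matrix ι ι ℂ, f.PosSemidef → (T f).PosSemidef)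
    {f : Matrix ι ι ℂ} (hf : f.IsHermitian) : (T f).IsHermitian := by
  have h := hermFC_eq_sum hf (fun x => x)
  rw [hermFC_id hf] at h
  have e : T f = ∑ i, (hf.eigenvalues i : ℂ) •
      T (colProj (hf.eigenvectorUnitary : Matrix ι ι ℂ) i) := by
    conv_lhs => rw [h]
    exact (map_sum (hT.mk' T) _ _).trans (Finset.sum_congr rfl fun i _ => map_smul (hT.mk' T) _ _)
  rw [e]
  refine isSelfAdjoint_sum _ fun i _ => ?_
  exact (hpos _ (posSemidef_colProj _ i)).isHermitian.smul (Complex.conj_ofReal _)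

/-- The quadratic form of a matrix at a vector, as a linear functional of the matrix. -/
def quadForm (v : ι → ℂ) : Matrix ι ι ℂ →ₗ[ℂ] ℂ where
  toFun A := star v ⬝ᵥ (A *ᵥ v)
  map_add' A B := by rw [Matrix.add_mulVec, dotProduct_add]
  map_smul' c A := by rw [Matrix.smul_mulVec, dotProduct_smul, RingHom.id_apply]

lemma continuous_linearMap_matrix {ι : Type*} [Fintype ι] (ℓ : Matrix ι ι ℂ →ₗ[ℂ] ℂ) :
    Continuous ℓ :=
  ℓ.continuous_of_finiteDimensional

lemma Matrix.IsHermitian.posSemidef_of_re_quadForm {ι : Type*} [Fintype ι]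
    {A : Matrix ι ι ℂ} (hA : A.IsHermitian)
    (h : ∀ v, 0 ≤ (quadForm v A).re) : A.PosSemidef :=
  Matrix.posSemidef_iff_dotProduct_mulVec.mpr ⟨hA, fun v =>
    Complex.nonneg_iff.mpr ⟨h v, (hA.im_star_dotProduct_mulVec_self v).symm⟩⟩

lemma Matrix.PosSemidef.re_quadForm_nonneg {ι : Type*} [Fintype ι] {A : Matrix ι ι ℂ}
    (hA : A.PosSemidef) (v : ι → ℂ) :
    0 ≤ (quadForm v A).re :=
  (Complex.nonneg_iff.mp (hA.dotProduct_mulVec_nonneg v)).1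

variable {T L : Matrix ι ι ℂ → Matrix ι ι ℂ} {c : ℝ}

lemma isHermitian_opExp (hT : IsLinearMap ℂ T)
    (hpos : ∀ f : Matrix ι ι ℂ, f.PosSemidef → (T f).PosSemidef)
    (hL : L = fun g => (c : ℂ) • (g - T g)) {f : Matrix ι ι ℂ} (hf : f.IsHermitian) (t : ℝ) :
    (opExp L t f).IsHermitian := by
  have hLk : ∀ k : ℕ, (L^[k] f).IsHermitian := by
    intro k
    induction k with
    | zero => exact hf
    | succ k ih =>
      rw [Function.iterate_succ_apply', hL]
      rw [hL] at ih
      exact (ih.sub (isHermitian_map hT hpos ih)).smul (Complex.conj_ofReal c)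
  have h := (opExp_properties hT hL).1 t f
  refine h.matrix_conjTranspose.unique ?_
  convert h using 2 with k
  exact (hLk k).smul (Complex.conj_ofReal _)

lemma re_quadForm_iterate_le_opExp (hT : IsLinearMap ℂ T)
    (hpos : ∀ f : Matrix ι ι ℂ, f.PosSemidef → (T f).PosSemidef) (hc : 0 ≤ c)
    (hL : L = fun g => (c : ℂ) • (g - T g)) {f : Matrix ι ι ℂ} (hf : f.PosSemidef) {t : ℝ}
    (ht : 0 ≤ t) (k : ℕ) (v : ι → ℂ) :
    Real.exp (-(c * t)) * ((c * t) ^ k / (Nat.factorial k)) * (quadForm v (T^[k] f)).re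
      ≤ (quadForm v (opExp L t f)).re := by
  have hTk : ∀ k : ℕ, (T^[k] f).PosSemidef := by
    intro k
    induction k with
    | zero => exact hf
    | succ k ih =>
      rw [Function.iterate_succ_apply']
      exact hpos _ ih
  have h := ((opExp_properties hT hL).2.1 t f).map
    (Complex.reAddGroupHom.comp (quadForm v).toAddMonoidHom)
    (Complex.continuous_re.comp (continuous_linearMap_matrix _))
  have h' : HasSum (fun k : ℕ => Real.exp (-(c * t)) * ((c * t) ^ k / (Nat.factorial k)) *
      (quadForm v (T^[k] f)).re) (quadForm v (opExp L t f)).re := by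
    convert h using 2 with k
    · change _ = (quadForm v _).re
      rw [map_smul, smul_eq_mul, Complex.re_ofReal_mul]
    · rfl
  refine le_hasSum h' k fun j _ => ?_
  have := (hTk j).re_quadForm_nonneg v
  positivity

lemma posSemidef_opExp_sub (hT : IsLinearMap ℂ T)
    (hpos : ∀ f : Matrix ι ι ℂ, f.PosSemidef → (T f).PosSemidef) (hc : 0 ≤ c)
    (hL : L = fun g => (c : ℂ) • (g - T g)) {f : Matrix ι ι ℂ} (hf : f.PosSemidef) {t : ℝ}
    (ht : 0 ≤ t) : (opExp L t f - ((Real.exp (-(c * t)) : ℝ) : ℂ) • f).PosSemidef := by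
  refine ((isHermitian_opExp hT hpos hL hf.isHermitian t).sub
    (hf.isHermitian.smul (Complex.conj_ofReal _))).posSemidef_of_re_quadForm fun v => ?_
  have h := re_quadForm_iterate_le_opExp hT hpos hc hL hf ht 0 v
  simp only [pow_zero, Nat.factorial_zero, Nat.cast_one, div_one, mul_one,
    Function.iterate_zero, id_eq] at h
  rw [map_sub, map_smul, smul_eq_mul, Complex.sub_re, Complex.re_ofReal_mul]
  linarith

lemma posSemidef_opExp (hT : IsLinearMap ℂ T)
    (hpos : ∀ f : Matrix ι ι ℂ, f.PosSemidef → (T f).PosSemidef) (hc : 0 ≤ c)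
    (hL : L = fun g => (c : ℂ) • (g - T g)) {f : Matrix ι ι ℂ} (hf : f.PosSemidef) {t : ℝ}
    (ht : 0 ≤ t) : (opExp L t f).PosSemidef := by
  have h := (posSemidef_opExp_sub hT hpos hc hL hf ht).add
    (hf.smul (show (0 : ℝ) ≤ Real.exp (-(c * t)) by positivity))
  rwa [← Complex.coe_smul, sub_add_cancel] at h

lemma posDef_opExp (hT : IsLinearMap ℂ T)
    (hpos : ∀ f : Matrix ι ι ℂ, f.PosSemidef → (T f).PosSemidef) (hc : 0 ≤ c)
    (hL : L = fun g => (c : ℂ) • (g - T g)) {f : Matrix ι ι ℂ} (hf : f.PosDef) {t : ℝ}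
    (ht : 0 ≤ t) : (opExp L t f).PosDef := by
  have h := (hf.smul (show (0 : ℝ) < Real.exp (-(c * t)) by positivity)).posSemidef_add
    (posSemidef_opExp_sub hT hpos hc hL hf.posSemidef ht)
  rwa [← Complex.coe_smul, sub_add_cancel] at h

/-- The semigroup of a primitive channel maps nonzero positive semidefinite matrices to positive
definite ones at every positive time. -/
lemma posDef_opExp_of_isPrimitive (hT : IsLinearMap ℂ T)
    (hpos : ∀ f : Matrix ι ι ℂ, f.PosSemidef → (T f).PosSemidef) (hprim : IsPrimitive T)
    (hc : 0 < c) (hL : L = fun g => (c : ℂ) • (g - T g)) {f : Matrix ι ι ℂ} (hf : f.PosSemidef)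
    (hf0 : f ≠ 0) {t : ℝ} (ht : 0 < t) : (opExp L t f).PosDef := by
  obtain ⟨σ, hσ, -, hlim⟩ := hprim
  have hS := posSemidef_opExp hT hpos hc.le hL hf ht.le
  refine Matrix.PosDef.of_dotProduct_mulVec_pos hS.isHermitian fun v hv => ?_
  rw [Complex.pos_iff]
  refine ⟨?_, (hS.isHermitian.im_star_dotProduct_mulVec_self v).symm⟩
  change 0 < (quadForm v (opExp L t f)).re
  by_contra hle
  have htr0 : f.trace ≠ 0 := fun h => hf0 (hf.trace_eq_zero_iff.mp h)
  have htr : 0 ≤ (f.trace)⁻¹ := inv_nonneg.mpr hf.trace_nonneg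
  have hρ : (f.trace⁻¹ • f).PosSemidef := hf.smul htr
  have hTk : ∀ k : ℕ, T^[k] (f.trace⁻¹ • f) = f.trace⁻¹ • T^[k] f := by
    intro k
    induction k with
    | zero => rfl
    | succ k ih => rw [Function.iterate_succ_apply', Function.iterate_succ_apply', ih, hT.map_smul]
  have h1 := hlim _ hρ (by rw [Matrix.trace_smul, smul_eq_mul, inv_mul_cancel₀ htr0])
  have h2 := ((Complex.continuous_re.comp (continuous_linearMap_matrix (quadForm v))).tendsto
    σ).comp h1
  have hσv : 0 < (quadForm v σ).re := (Complex.pos_iff.mp (hσ.dotProduct_mulVec_pos hv)).1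
  refine absurd (le_of_tendsto' h2 fun k => ?_) (not_le.mpr hσv)
  have hk := re_quadForm_iterate_le_opExp hT hpos hc.le hL hf ht.le k v
  have hk' : (quadForm v (T^[k] f)).re ≤ 0 := by
    have hcoef : 0 < Real.exp (-(c * t)) * ((c * t) ^ k / (Nat.factorial k)) := by positivity
    by_contra hcon
    nlinarith [mul_pos hcoef (not_le.mp hcon)]
  change (quadForm v (T^[k] (f.trace⁻¹ • f))).re ≤ 0
  obtain ⟨r, hr, hr'⟩ : ∃ r : ℝ, 0 ≤ r ∧ f.trace⁻¹ = (r : ℂ) :=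
    ⟨(f.trace⁻¹).re, (Complex.nonneg_iff.mp htr).1, by
      apply Complex.ext
      · simp only [Complex.ofReal_re]
      · rw [Complex.ofReal_im, (Complex.nonneg_iff.mp htr).2]⟩
  rw [hTk, map_smul, smul_eq_mul, hr', Complex.re_ofReal_mul]
  exact mul_nonpos_of_nonneg_of_nonpos hr hk'

lemma opExp_zero (L : Matrix ι ι ℂ → Matrix ι ι ℂ) (f : Matrix ι ι ℂ) : opExp L 0 f = f := by
  rw [opExp, tsum_eq_single 0]
  · simp
  · intro k hk
    simp [hk]

lemma opExp_of_map_eq_zero (hL0 : L 0 = 0) {f : Matrix ι ι ℂ} (hf : L f = 0) (t : ℝ) :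
    opExp L t f = f := by
  rw [opExp, tsum_eq_single 0]
  · simp
  · intro k hk
    obtain ⟨j, rfl⟩ := Nat.exists_eq_succ_of_ne_zero hk
    rw [Function.iterate_succ_apply, hf, Function.iterate_fixed hL0, smul_zero]

lemma trace_opExp (hT : IsLinearMap ℂ T) (htr : ∀ f, (T f).trace = f.trace)
    (hL : L = fun g => (c : ℂ) • (g - T g)) (t : ℝ) (f : Matrix ι ι ℂ) :
    (opExp L t f).trace = f.trace := by
  have h := ((opExp_properties hT hL).1 t f).map (Matrix.traceLinearMap ι ℂ ℂ)
    (continuous_linearMap_matrix _)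
  have h0 : HasSum (fun k : ℕ => (Matrix.traceLinearMap ι ℂ ℂ)
      ((((-t) ^ k / (Nat.factorial k) : ℝ) : ℂ) • L^[k] f)) f.trace := by
    convert hasSum_single (f := fun k : ℕ => (Matrix.traceLinearMap ι ℂ ℂ)
      ((((-t) ^ k / (Nat.factorial k) : ℝ) : ℂ) • L^[k] f)) 0 ?_ using 1
    · simp
    · intro k hk
      obtain ⟨j, rfl⟩ := Nat.exists_eq_succ_of_ne_zero hk
      rw [map_smul, Function.iterate_succ_apply', hL]
      simp [htr]
  exact h.unique h0

end Channel

section Flow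

variable {ι : Type*} [Fintype ι] [DecidableEq ι]

/-- The linear functional whose real part is `diagIn V · i`. -/
def diagFunctional (V : Matrix ι ι ℂ) (i : ι) : Matrix ι ι ℂ →ₗ[ℂ] ℂ :=
  (Matrix.traceLinearMap ι ℂ ℂ).comp (LinearMap.mulLeft ℂ (colProj V i))

lemma diagIn_eq_re (V B : Matrix ι ι ℂ) (i : ι) : diagIn V B i = (diagFunctional V i B).re :=
  diagIn_eq_trace V B i

lemma diagIn_sub (V A B : Matrix ι ι ℂ) (i : ι) :
    diagIn V (A - B) i = diagIn V A i - diagIn V B i := by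
  simp only [diagIn_eq_re, map_sub, Complex.sub_re]

lemma diagIn_smul (V A : Matrix ι ι ℂ) (r : ℝ) (i : ι) :
    diagIn V ((r : ℂ) • A) i = r * diagIn V A i := by
  simp only [diagIn_eq_re, map_smul, smul_eq_mul, Complex.re_ofReal_mul]

lemma diagIn_sum_smul (V : Matrix ι ι ℂ) (φ : ι → ℝ) (A : ι → Matrix ι ι ℂ) (i : ι) :
    diagIn V (∑ j, (φ j : ℂ) • A j) i = ∑ j, diagIn V (A j) i * φ j := by
  simp only [diagIn_eq_re, map_sum, Complex.re_sum, map_smul, smul_eq_mul, Complex.re_ofReal_mul,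
    mul_comm]

/-- The compression of `L` to the diagonal in the orthonormal basis of columns of `V`. -/
noncomputable def compress (L : Matrix ι ι ℂ → Matrix ι ι ℂ) (V : Matrix ι ι ℂ) (i j : ι) : ℝ :=
  diagIn V (L (colProj V j)) i

/-- A reversible unital positive generator `L = c (id - T)` with a `2`-log-Sobolev inequality. -/
structure IsLogSobolevGenerator (T L : Matrix ι ι ℂ → Matrix ι ι ℂ) (c α : ℝ) : Prop where
  linear : IsLinearMap ℂ T
  pos : ∀ f : Matrix ι ι ℂ, f.PosSemidef → (T f).PosSemidef
  map_one : T 1 = 1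
  rev : IsReversible T
  c_pos : 0 < c
  eq : L = fun g => (c : ℂ) • (g - T g)
  α_pos : 0 < α
  lsi : ∀ g : Matrix ι ι ℂ, g.PosSemidef → mEnt (g * g) ≤ α * dirichlet L g g

namespace IsLogSobolevGenerator

variable {T L : Matrix ι ι ℂ → Matrix ι ι ℂ} {c α : ℝ}

lemma diagIn_apply (h : IsLogSobolevGenerator T L c α) (V A : Matrix ι ι ℂ) (i : ι) :
    diagIn V (L A) i = c * (diagIn V A i - diagIn V (T A) i) := by
  rw [h.eq, diagIn_smul, diagIn_sub]

lemma diagIn_sum (h : IsLogSobolevGenerator T L c α) (V : Matrix ι ι ℂ) (φ : ι → ℝ) (i : ι) :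
    diagIn V (L (∑ j, (φ j : ℂ) • colProj V j)) i = ∑ j, compress L V i j * φ j := by
  have hT : T (∑ j, (φ j : ℂ) • colProj V j) = ∑ j, (φ j : ℂ) • T (colProj V j) :=
    (map_sum (h.linear.mk' T) _ _).trans
      (Finset.sum_congr rfl fun _ _ => map_smul (h.linear.mk' T) _ _)
  rw [h.diagIn_apply, hT, diagIn_sum_smul, diagIn_sum_smul, ← Finset.sum_sub_distrib,
    Finset.mul_sum]
  refine Finset.sum_congr rfl fun j _ => ?_
  rw [compress, h.diagIn_apply]
  ring

lemma compress_symm (h : IsLogSobolevGenerator T L c α) (V : Matrix ι ι ℂ) (i j : ι) :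
    compress L V i j = compress L V j i := by
  rw [compress, compress, h.diagIn_apply, h.diagIn_apply]
  simp only [diagIn_eq_trace]
  rw [Matrix.trace_mul_comm (colProj V i) (colProj V j), h.rev,
    Matrix.trace_mul_comm (T (colProj V i))]

lemma sum_compress (h : IsLogSobolevGenerator T L c α) (V : Matrix.unitaryGroup ι ℂ) (i : ι) :
    ∑ j, compress L V i j = 0 := by
  have h1 := h.diagIn_sum V (fun _ => 1) i
  simp only [Complex.ofReal_one, one_smul, mul_one, sum_colProj] at h1
  rw [← h1, h.diagIn_apply, h.map_one, sub_self, mul_zero]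

lemma compress_nonpos (h : IsLogSobolevGenerator T L c α) (V : Matrix.unitaryGroup ι ℂ)
    {i j : ι} (hij : i ≠ j) : compress L V i j ≤ 0 := by
  rw [compress, h.diagIn_apply, diagIn_eq_trace _ (colProj _ _), colProj_mul_colProj V hij,
    Matrix.trace_zero, Complex.zero_re, zero_sub]
  exact mul_nonpos_of_nonneg_of_nonpos h.c_pos.le
    (neg_nonpos.mpr (diagIn_nonneg _ (h.pos _ (posSemidef_colProj _ j)) i))

lemma dirichlet_hermFC (h : IsLogSobolevGenerator T L c α) {A : Matrix ι ι ℂ}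
    (hA : A.IsHermitian) (φ : ℝ → ℝ) :
    dirichlet L (hermFC φ A) (hermFC φ A) =
      (∑ i, ∑ j, compress L hA.eigenvectorUnitary i j * φ (hA.eigenvalues i) *
        φ (hA.eigenvalues j)) / Fintype.card ι := by
  rw [dirichlet, ntrace]
  congr 1
  have h1 : (hermFC φ A * L (hermFC φ A)).trace = ∑ i, (φ (hA.eigenvalues i) : ℂ) *
      (colProj (hA.eigenvectorUnitary : Matrix ι ι ℂ) i * L (hermFC φ A)).trace := by
    conv_lhs => rw [hermFC_eq_sum hA φ, Finset.sum_mul, Matrix.trace_sum, ← hermFC_eq_sum hA φ]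
    exact Finset.sum_congr rfl fun i _ => by rw [smul_mul_assoc, Matrix.trace_smul, smul_eq_mul]
  rw [h1, Complex.re_sum]
  refine Finset.sum_congr rfl fun i _ => ?_
  rw [Complex.re_ofReal_mul, ← diagIn_eq_trace, hermFC_eq_sum hA φ, h.diagIn_sum, Finset.mul_sum]
  exact Finset.sum_congr rfl fun j _ => by ring

lemma entropy_le (h : IsLogSobolevGenerator T L c α) {A : Matrix ι ι ℂ} (hA : A.PosDef) (q : ℝ) :
    (∑ i, hA.isHermitian.eigenvalues i ^ q * Real.log (hA.isHermitian.eigenvalues i ^ q)) /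
        Fintype.card ι
      - powMean q hA.isHermitian.eigenvalues * Real.log (powMean q hA.isHermitian.eigenvalues)
      ≤ α * ((∑ i, ∑ j, compress L hA.isHermitian.eigenvectorUnitary i j *
          hA.isHermitian.eigenvalues i ^ (q / 2) * hA.isHermitian.eigenvalues j ^ (q / 2)) /
        Fintype.card ι) := by
  have hH := hA.isHermitian
  have hg : (hermFC (fun x => x ^ (q / 2)) A).PosSemidef := by
    rw [hermFC_eq_sum hH]
    exact Matrix.posSemidef_sum _ fun i _ => (posSemidef_colProj _ i).smul
      (Complex.zero_le_real.mpr (Real.rpow_nonneg (hA.eigenvalues_pos i).le _))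
  have hsq : ∀ i, hH.eigenvalues i ^ (q / 2) * hH.eigenvalues i ^ (q / 2) =
      hH.eigenvalues i ^ q := by
    intro i
    rw [← Real.rpow_add (hA.eigenvalues_pos i), add_halves]
  have h1 := h.lsi _ hg
  rw [h.dirichlet_hermFC hH, hermFC_mul_hermFC hH, mEnt, hermFC_hermFC hH, ntrace_hermFC hH,
    ntrace_hermFC hH] at h1
  simpa only [hsq, powMean] using h1

lemma posDef_opExp (h : IsLogSobolevGenerator T L c α) {f : Matrix ι ι ℂ} (hf : f.PosDef) {t : ℝ}
    (ht : 0 ≤ t) : (opExp L t f).PosDef :=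
  _root_.posDef_opExp h.linear h.pos h.c_pos.le h.eq hf ht

lemma hasDerivAt_diagIn_opExp (h : IsLogSobolevGenerator T L c α) (f : Matrix ι ι ℂ) (x : ℝ)
    (hA : (opExp L x f).IsHermitian) (i : ι) :
    HasDerivAt (fun s => diagIn hA.eigenvectorUnitary (opExp L s f) i)
      (-∑ j, compress L hA.eigenvectorUnitary i j *
        diagIn hA.eigenvectorUnitary (opExp L x f) j) x := by
  have h1 := (opExp_properties h.linear h.eq).2.2.2.2
    (diagFunctional hA.eigenvectorUnitary i) x f
  simp only [← diagIn_eq_re] at h1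
  convert h1 using 2
  rw [diagIn_eigenvectorUnitary hA, ← h.diagIn_sum, ← hermFC_eq_sum hA (fun x => x), hermFC_id hA]

variable [Nonempty ι]

lemma exists_hasDerivAt_nonneg (h : IsLogSobolevGenerator T L c α) {f : Matrix ι ι ℂ} {x : ℝ}
    (hA : (opExp L x f).PosDef) {κ : ℝ} (hκ : 0 ≤ κ) (hκα : κ ≤ 4 / α) {Q : ℝ → ℝ} (hq : Q x < 1)
    (hq0 : Q x ≠ 0) (hQ : HasDerivAt Q (-(κ * (1 - Q x))) x) :
    ∃ D, 0 ≤ D ∧ HasDerivAt (fun s => Real.log (powMean (Q s)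
      (diagIn hA.isHermitian.eigenvectorUnitary (opExp L s f))) / Q s) D x := by
  refine exists_hasDerivAt_logNorm_nonneg
    (β := fun s => diagIn hA.isHermitian.eigenvectorUnitary (opExp L s f))
    (h.compress_symm hA.isHermitian.eigenvectorUnitary)
    (h.sum_compress hA.isHermitian.eigenvectorUnitary)
    (fun i j => h.compress_nonpos hA.isHermitian.eigenvectorUnitary) h.α_pos hκ hκα hq hq0
    (diagIn_pos _ hA) hQ (h.hasDerivAt_diagIn_opExp f x hA.isHermitian) ?_
  have := h.entropy_le hA (Q x)
  rwa [← diagIn_eigenvectorUnitary hA.isHermitian] at this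

end IsLogSobolevGenerator

/-- The eigenvalues of a Hermitian matrix (and `0` for other matrices). -/
noncomputable def evals (A : Matrix ι ι ℂ) : ι → ℝ :=
  if h : A.IsHermitian then h.eigenvalues else 0

lemma evals_eq {A : Matrix ι ι ℂ} (hA : A.IsHermitian) : evals A = hA.eigenvalues := dif_pos hA

lemma evals_pos {A : Matrix ι ι ℂ} (hA : A.PosDef) (i : ι) : 0 < evals A i := by
  rw [evals_eq hA.isHermitian]
  exact hA.eigenvalues_pos i

namespace IsLogSobolevGenerator

variable {T L : Matrix ι ι ℂ → Matrix ι ι ℂ} {c α : ℝ} [Nonempty ι]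

lemma logNorm_le_add (h : IsLogSobolevGenerator T L c α) {f : Matrix ι ι ℂ} (hf : f.PosDef)
    {x s r : ℝ} (hx : 0 ≤ x) (hxs : x ≤ s) (hr : r < 1) (hr0 : r ≠ 0) :
    logNorm r (evals (opExp L x f)) ≤ logNorm r (evals (opExp L s f)) + c * (s - x) := by
  have hX := h.posDef_opExp hf hx
  have hS := h.posDef_opExp hf (hx.trans hxs)
  set V := hS.isHermitian.eigenvectorUnitary
  have hsplit : opExp L s f = opExp L (s - x) (opExp L x f) := by
    rw [← (opExp_properties h.linear h.eq).2.2.1, sub_add_cancel]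
  have hle : ∀ i, Real.exp (-(c * (s - x))) * diagIn V (opExp L x f) i ≤
      evals (opExp L s f) i := by
    intro i
    have h1 := diagIn_nonneg (V : Matrix ι ι ℂ) (posSemidef_opExp_sub h.linear h.pos h.c_pos.le
      h.eq hX.posSemidef (sub_nonneg.mpr hxs)) i
    rw [← hsplit, diagIn_sub, diagIn_smul, diagIn_eigenvectorUnitary] at h1
    rw [evals_eq hS.isHermitian]
    linarith
  have hV := diagIn_pos V hX
  have h1 := logNorm_mono hr0 (fun i => mul_pos (Real.exp_pos _) (hV i)) hle
  rw [logNorm_const_mul hr0 hV (Real.exp_pos _), Real.log_exp] at h1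
  have h2 := logNorm_eigenvalues_le_diagIn hr hr0 hX V
  rw [← evals_eq] at h2
  linarith

open Filter Topology in
/-- Along the flow, the `ℓ_Q` norm is nondecreasing as long as the exponent `Q` does not cross
zero. -/
lemma logNorm_le_of_ne_zero (h : IsLogSobolevGenerator T L c α) {f : Matrix ι ι ℂ} (hf : f.PosDef)
    {κ : ℝ} (hκ : 0 ≤ κ) (hκα : κ ≤ 4 / α) {Q : ℝ → ℝ} (hQ1 : ∀ s, Q s < 1)
    (hQ : ∀ s, HasDerivAt Q (-(κ * (1 - Q s))) s) {a b : ℝ} (ha : 0 ≤ a) (hab : a ≤ b)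
    (hQ0 : ∀ s ∈ Set.Ioc a b, Q s ≠ 0) :
    logNorm (Q a) (evals (opExp L a f)) ≤ logNorm (Q b) (evals (opExp L b f)) := by
  refine le_of_left_dini_nonneg (g := fun s => logNorm (Q s) (evals (opExp L s f))) hab ?_ ?_
  · intro x hx r hr
    have hA := h.posDef_opExp hf (ha.trans hx.1.le)
    obtain ⟨D, hD, hΦ⟩ := h.exists_hasDerivAt_nonneg hA hκ hκα (hQ1 x) (hQ0 x hx) (hQ x)
    have hslope := (hasDerivAt_iff_isLittleO.mp hΦ).def hr
    filter_upwards [nhdsWithin_le_nhds hslope, Ioo_mem_nhdsLT hx.1] with s hs hsx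
    have hs0 := hQ0 s ⟨hsx.1, hsx.2.le.trans hx.2⟩
    have hS := h.posDef_opExp hf (ha.trans hsx.1.le)
    have h1 := logNorm_eigenvalues_le_diagIn (hQ1 s) hs0 hS hA.isHermitian.eigenvectorUnitary
    rw [← evals_eq, logNorm_of_ne hs0 (diagIn _ _)] at h1
    have h2 : logNorm (Q x) (evals (opExp L x f)) = Real.log (powMean (Q x)
        (diagIn hA.isHermitian.eigenvectorUnitary (opExp L x f))) / Q x := by
      rw [diagIn_eigenvectorUnitary, ← evals_eq, logNorm_of_ne (hQ0 x hx)]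
    rw [Real.norm_eq_abs, Real.norm_eq_abs, abs_of_neg (sub_neg.mpr hsx.2), smul_eq_mul] at hs
    have h3 := (abs_le.mp hs).2
    have h4 := mul_nonneg (sub_nonneg.mpr hsx.2.le) hD
    simp only [h2]
    linarith
  · intro x hx ε hε
    have hX := h.posDef_opExp hf (ha.trans hx.1)
    have hcont : Continuous fun s => logNorm (Q s) (evals (opExp L x f)) - c * (s - x) :=
      ((continuous_logNorm (evals_pos hX)).comp
        (continuous_iff_continuousAt.mpr fun s => (hQ s).continuousAt)).sub (by fun_prop)
    have hev := (hcont.tendsto x).eventually (lt_mem_nhds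
      (show logNorm (Q x) (evals (opExp L x f)) - ε <
        logNorm (Q x) (evals (opExp L x f)) - c * (x - x) by simpa using hε))
    filter_upwards [nhdsWithin_le_nhds hev, Ioc_mem_nhdsGT hx.2] with s hs hsx
    have h1 := h.logNorm_le_add hf (ha.trans hx.1) hsx.1.le (hQ1 s)
      (hQ0 s ⟨hx.1.trans_lt hsx.1, hsx.2⟩)
    linarith

open Filter Topology in
lemma logNorm_le (h : IsLogSobolevGenerator T L c α) {f : Matrix ι ι ℂ} (hf : f.PosDef)
    {κ : ℝ} (hκ : 0 < κ) (hκα : κ ≤ 4 / α) {Q : ℝ → ℝ} (hQ1 : ∀ s, Q s < 1)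
    (hQ : ∀ s, HasDerivAt Q (-(κ * (1 - Q s))) s) {t : ℝ} (ht : 0 ≤ t) :
    logNorm (Q 0) (evals (opExp L 0 f)) ≤ logNorm (Q t) (evals (opExp L t f)) := by
  have hanti : StrictAnti Q := by
    refine strictAnti_of_hasDerivAt_neg hQ fun s => ?_
    have := mul_pos hκ (sub_pos.mpr (hQ1 s))
    linarith
  have hQc : Continuous Q := continuous_iff_continuousAt.mpr fun s => (hQ s).continuousAt
  by_cases hcross : ∃ x ∈ Set.Icc 0 t, Q x = 0
  · obtain ⟨x, hx, hx0⟩ := hcross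
    refine le_trans ?_ (h.logNorm_le_of_ne_zero hf hκ.le hκα hQ1 hQ hx.1 hx.2 fun s hs => ?_)
    · rcases hx.1.eq_or_lt with rfl | hxpos
      · exact le_rfl
      have hX := h.posDef_opExp hf hx.1
      have hcont : Continuous fun s => logNorm (Q s) (evals (opExp L x f)) + c * (x - s) :=
        ((continuous_logNorm (evals_pos hX)).comp hQc).add (by fun_prop)
      have hlim := (hcont.tendsto x).mono_left (nhdsWithin_le_nhds (s := Set.Iio x))
      rw [sub_self, mul_zero, add_zero] at hlim
      refine ge_of_tendsto hlim ?_
      filter_upwards [Ioo_mem_nhdsLT hxpos] with s hs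
      have hne : ∀ u < x, Q u ≠ 0 := fun u hu => (hx0.symm.trans_lt (hanti hu)).ne'
      exact (h.logNorm_le_of_ne_zero hf hκ.le hκα hQ1 hQ le_rfl hs.1.le
        fun u hu => hne u (hu.2.trans_lt hs.2)).trans
        (h.logNorm_le_add hf hs.1.le hs.2.le (hQ1 s) (hne s hs.2))
    · exact ((hanti hs.1).trans_eq hx0).ne
  · push Not at hcross
    exact h.logNorm_le_of_ne_zero hf hκ.le hκα hQ1 hQ le_rfl ht
      fun s hs => hcross s (Set.Ioc_subset_Icc_self hs)

lemma logNorm_eq_log_snorm {A : Matrix ι ι ℂ} (hA : A.PosDef) {r : ℝ} (hr : r ≠ 0) :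
    logNorm r (evals A) = Real.log (snorm r A) := by
  rw [logNorm_of_ne hr, evals_eq hA.isHermitian, snorm_eq_of_posSemidef hA.posSemidef,
    Real.log_rpow (powMean_pos hA.eigenvalues_pos r)]
  ring

lemma snorm_pos {A : Matrix ι ι ℂ} (hA : A.PosDef) (r : ℝ) : 0 < snorm r A := by
  rw [snorm_eq_of_posSemidef hA.posSemidef]
  exact Real.rpow_pos_of_pos (powMean_pos hA.eigenvalues_pos r) _

lemma snorm_le_of_posDef (h : IsLogSobolevGenerator T L c α) {f : Matrix ι ι ℂ} (hf : f.PosDef)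
    {p q t : ℝ} (hqp : q ≤ p) (hp1 : p < 1) (hp0 : p ≠ 0) (hq0 : q ≠ 0) (ht0 : 0 < t)
    (ht : 1 - q ≤ Real.exp (4 * t / α) * (1 - p)) : snorm p f ≤ snorm q (opExp L t f) := by
  have hft := h.posDef_opExp hf ht0.le
  have hp : 0 < 1 - p := sub_pos.mpr hp1
  have hq : 0 < 1 - q := by linarith
  set κ := Real.log ((1 - q) / (1 - p)) / t with hκdef
  have hκt : Real.exp (κ * t) = (1 - q) / (1 - p) := by
    rw [hκdef, div_mul_cancel₀ _ ht0.ne', Real.exp_log (div_pos hq hp)]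
  have hκ : 0 ≤ κ := div_nonneg (Real.log_nonneg ((one_le_div hp).mpr (by linarith))) ht0.le
  have hκα : κ ≤ 4 / α := by
    rw [hκdef, div_le_iff₀ ht0, div_mul_eq_mul_div, Real.log_le_iff_le_exp (div_pos hq hp),
      div_le_iff₀ hp]
    exact ht
  set Q : ℝ → ℝ := fun s => 1 - (1 - p) * Real.exp (κ * s) with hQdef
  have hQ1 : ∀ s, Q s < 1 := fun s => sub_lt_self _ (mul_pos hp (Real.exp_pos _))
  have hQ : ∀ s, HasDerivAt Q (-(κ * (1 - Q s))) s := by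
    intro s
    have h1 := ((((hasDerivAt_id s).const_mul κ).exp).const_mul (1 - p)).const_sub 1
    refine h1.congr_deriv ?_
    simp only [hQdef, id_eq]
    ring
  have hQ0 : Q 0 = p := by simp [hQdef]
  have hQt : Q t = q := by
    simp only [hQdef, hκt]
    field_simp
    ring
  have key : logNorm p (evals f) ≤ logNorm q (evals (opExp L t f)) := by
    rcases hκ.eq_or_lt with h0 | h0
    · have hconst : ∀ s, Q s = p := fun s => by simp [hQdef, ← h0]
      have := h.logNorm_le_of_ne_zero hf hκ hκα hQ1 hQ le_rfl ht0.le
        fun s _ => by rw [hconst]; exact hp0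
      rwa [hQ0, hQt, opExp_zero] at this
    · have := h.logNorm_le hf h0 hκα hQ1 hQ ht0.le
      rwa [hQ0, hQt, opExp_zero] at this
  rw [logNorm_eq_log_snorm hf hp0, logNorm_eq_log_snorm hft hq0] at key
  exact (Real.log_le_log_iff (snorm_pos hf p) (snorm_pos hft q)).mp key

open Filter Topology in
lemma snorm_le_of_pos (h : IsLogSobolevGenerator T L c α) {f : Matrix ι ι ℂ} (hf : f.PosSemidef)
    {p q t : ℝ} (hqp : q ≤ p) (hp1 : p < 1) (hp0 : 0 < p) (hq0 : q ≠ 0) (ht0 : 0 < t)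
    (hft : (opExp L t f).PosDef) (ht : 1 - q ≤ Real.exp (4 * t / α) * (1 - p)) :
    snorm p f ≤ snorm q (opExp L t f) := by
  set B := opExp L t f
  have hcont : ContinuousAt (fun ε : ℝ =>
      powMean q (fun i => |hft.isHermitian.eigenvalues i + ε|) ^ (1 / q)) 0 := by
    have hpos : ∀ i, 0 < |hft.isHermitian.eigenvalues i + 0| := fun i => by
      rw [add_zero]
      exact abs_pos.mpr (hft.eigenvalues_pos i).ne'
    refine ContinuousAt.rpow_const ?_ (Or.inl (powMean_pos hpos q).ne')
    refine ContinuousAt.div_const ?_ _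
    refine tendsto_finsetSum _ fun i _ => ?_
    exact ContinuousAt.rpow_const (by fun_prop) (Or.inl (hpos i).ne')
  have hlim := hcont.tendsto.mono_left (nhdsWithin_le_nhds (s := Set.Ioi 0))
  simp only [add_zero] at hlim
  rw [snorm_eq hft.isHermitian q]
  refine ge_of_tendsto hlim ?_
  filter_upwards [self_mem_nhdsWithin] with ε (hε : 0 < ε)
  have hL0 : L 0 = 0 := by
    rw [h.eq]
    simp [h.linear.map_zero]
  have hL1 : L ((ε : ℂ) • 1) = 0 := by
    simp only [h.eq]
    rw [h.linear.map_smul, h.map_one, sub_self, smul_zero]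
  have hsplit : opExp L t (f + (ε : ℂ) • 1) = B + (ε : ℂ) • 1 := by
    rw [(opExp_properties h.linear h.eq).2.2.2.1, opExp_of_map_eq_zero hL0 hL1]
  have hfε : (f + (ε : ℂ) • 1).PosDef :=
    Matrix.PosDef.posSemidef_add hf (Matrix.PosDef.one.smul (Complex.zero_lt_real.mpr hε))
  have h1 := h.snorm_le_of_posDef hfε hqp hp1 hp0.ne' hq0 ht0 ht
  rw [hsplit, ← hermFC_add_const hft.isHermitian, ← hermFC_add_const hf.isHermitian,
    snorm_hermFC hft.isHermitian, snorm_hermFC hf.isHermitian] at h1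
  refine le_trans ?_ h1
  rw [snorm_eq hf.isHermitian]
  have hnn : ∀ i, 0 ≤ hf.isHermitian.eigenvalues i := hf.eigenvalues_nonneg
  refine Real.rpow_le_rpow (div_nonneg (Finset.sum_nonneg fun i _ =>
    Real.rpow_nonneg (abs_nonneg _) _) (Nat.cast_nonneg _)) ?_ (one_div_nonneg.mpr hp0.le)
  refine div_le_div_of_nonneg_right (Finset.sum_le_sum fun i _ => ?_) (Nat.cast_nonneg _)
  refine Real.rpow_le_rpow (abs_nonneg _) ?_ hp0.le
  simp only [abs_of_nonneg (hnn i), abs_of_nonneg (add_nonneg (hnn i) hε.le)]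
  exact le_add_of_nonneg_right hε.le

end IsLogSobolevGenerator

lemma ntrace_eq_sum_eigenvalues {A : Matrix ι ι ℂ} (hA : A.IsHermitian) :
    ntrace A = (∑ i, hA.eigenvalues i) / Fintype.card ι := by
  conv_lhs => rw [← hermFC_id hA]
  exact ntrace_hermFC hA _

lemma snorm_one_of_posSemidef {A : Matrix ι ι ℂ} (hA : A.PosSemidef) : snorm 1 A = ntrace A := by
  rw [snorm_eq_of_posSemidef hA, ntrace_eq_sum_eigenvalues hA.isHermitian, powMean]
  simp

lemma ntrace_le_snorm_one {A : Matrix ι ι ℂ} (hA : A.IsHermitian) : ntrace A ≤ snorm 1 A := by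
  rw [snorm_eq hA, ntrace_eq_sum_eigenvalues hA, powMean]
  simp only [Real.rpow_one, div_one]
  exact div_le_div_of_nonneg_right (Finset.sum_le_sum fun i _ => le_abs_self _)
    (Nat.cast_nonneg _)

lemma snorm_nonneg {A : Matrix ι ι ℂ} (hA : A.IsHermitian) (p : ℝ) : 0 ≤ snorm p A := by
  rw [snorm_eq hA]
  exact Real.rpow_nonneg (div_nonneg (Finset.sum_nonneg fun i _ =>
    Real.rpow_nonneg (abs_nonneg _) _) (Nat.cast_nonneg _)) _

lemma snorm_zero {p : ℝ} (hp : p ≠ 0) : snorm p (0 : Matrix ι ι ℂ) = 0 := by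
  have h : (0 : Matrix ι ι ℂ) = hermFC (fun _ => 0) 0 := by
    simp [hermFC_eq_sum Matrix.isHermitian_zero]
  rw [h, snorm_hermFC Matrix.isHermitian_zero, powMean]
  simp [Real.zero_rpow hp, Real.zero_rpow (inv_ne_zero hp)]

end Flow

/-- Reverse hypercontractivity from the 2-log-Sobolev inequality.
The hypothesis `1 - q ≤ e^{4t/α} (1 - p)` is the division-free form of
`t ≥ (α/4) ln((1−q)/(1−p))` (and interprets the bound correctly in the limit `p = 1`). -/
theorem reverse_hypercontractivity_from_log_sobolev
    (d : ℕ) (hd : 0 < d)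
    (T : Matrix (Fin d) (Fin d) ℂ → Matrix (Fin d) (Fin d) ℂ)
    (hT : IsQChannel T) (hTu : T 1 = 1) (hTrev : IsReversible T)
    (hTprim : IsPrimitive T)
    (c₀ : ℝ) (hc₀ : 0 < c₀)
    (L : Matrix (Fin d) (Fin d) ℂ → Matrix (Fin d) (Fin d) ℂ)
    (hL : L = fun g => (c₀ : ℂ) • (g - T g))
    (α : ℝ) (hα : 0 < α)
    (hLSI : ∀ g : Matrix (Fin d) (Fin d) ℂ, g.PosSemidef →
      mEnt (g * g) ≤ α * dirichlet L g g)
    (f : Matrix (Fin d) (Fin d) ℂ) (hf : f.PosSemidef)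
    (p q : ℝ) (hqp : q ≤ p) (hp1 : p ≤ 1) (hp0 : p ≠ 0) (hq0 : q ≠ 0)
    (hfd : p < 0 → f.PosDef)
    (t : ℝ) (ht : 1 - q ≤ Real.exp (4 * t / α) * (1 - p)) :
    snorm p f ≤ snorm q (opExp L t f) := by
  have : Nonempty (Fin d) := ⟨⟨0, hd⟩⟩
  obtain ⟨hlin, hcp, htr⟩ := hT
  have hpos : ∀ g : Matrix (Fin d) (Fin d) ℂ, g.PosSemidef → (T g).PosSemidef :=
    fun _ hg => hcp.posSemidef hg
  have h : IsLogSobolevGenerator T L c₀ α := ⟨hlin, hpos, hTu, hTrev, hc₀, hL, hα, hLSI⟩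
  have hherm := isHermitian_opExp hlin hpos hL hf.isHermitian t
  rcases hp1.eq_or_lt with rfl | hp1
  · obtain rfl : q = 1 := le_antisymm hqp (by linarith)
    rw [snorm_one_of_posSemidef hf]
    refine le_of_eq_of_le ?_ (ntrace_le_snorm_one hherm)
    rw [ntrace, ntrace, trace_opExp hlin htr hL]
  have ht0 : 0 ≤ t := by
    have hexp : 1 ≤ Real.exp (4 * t / α) := by
      by_contra! hlt
      nlinarith
    have h1 := mul_nonneg (Real.one_le_exp_iff.mp hexp) hα.le
    rw [div_mul_cancel₀ _ hα.ne'] at h1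
    linarith
  rcases ht0.eq_or_lt with rfl | ht0
  · obtain rfl : q = p := le_antisymm hqp (by
      rw [mul_zero, zero_div, Real.exp_zero] at ht
      linarith)
    rw [opExp_zero]
  rcases lt_or_gt_of_ne hp0 with hneg | hp
  · exact h.snorm_le_of_posDef (hfd hneg) hqp hp1 hp0 hq0 ht0 ht
  · rcases eq_or_ne f 0 with rfl | hf0
    · rw [snorm_zero hp0]
      exact snorm_nonneg hherm q
    · exact h.snorm_le_of_pos hf hqp hp1 hp hq0 ht0
        (posDef_opExp_of_isPrimitive hlin hpos hTprim hc₀ hL hf hf0 ht0) ht
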